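/- Let N ⊆ ℕ be a set of positive density whose characteristic function f (f(n) = 1 if n ∈ N, f(n) = 0 otherwise) is multiplicative. Then N is extremal. -/

import Mathlib

open MeasureTheory Filter Finset
open scoped Classical

/-- `e t = exp(2πit)`. -/
noncomputable def e (t : ℝ) : ℂ := Complex.exp (2 * Real.pi * Complex.I * t)

/-- `N` has (natural) density `ρ`. -/
def HasDensity (N : Set ℕ) (ρ : ℝ) : Prop :=
  Filter.Tendsto (fun x : ℕ => (((Finset.Icc 1 x).filter (fun n => n ∈ N)).card : ℝ) / x)
    Filter.atTop (nhds ρ)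

/-- `N` has density `d` in the residue class `a` modulo `q`. -/
def HasResidueDensity (N : Set ℕ) (q a : ℕ) (d : ℝ) : Prop :=
  Filter.Tendsto (fun x : ℕ =>
      (((Finset.Icc 1 x).filter (fun n => n ∈ N ∧ n % q = a % q)).card : ℝ) / x)
    Filter.atTop (nhds d)

/-- `N` is distributed: all residue class densities exist. -/
def Distributed (N : Set ℕ) : Prop := ∀ q, 1 ≤ q → ∀ a, ∃ d, HasResidueDensity N q a d

/-- The singular series `∑_{q≥1} ∑_{(a,q)=1} |∑_{b=1}^q (F(q,b)/ρ) e(ab/q)|²`. -/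
noncomputable def extremalSum (F : ℕ → ℕ → ℝ) (ρ : ℝ) : ℝ :=
  ∑' q : ℕ, ∑ a ∈ (Finset.Icc 1 q).filter (fun a => Nat.Coprime a q),
    ‖∑ b ∈ Finset.Icc 1 q, ((F q b / ρ : ℝ) : ℂ) * e (((a : ℝ) * b) / q)‖ ^ 2

/-- `N` is extremal. -/
def Extremal (N : Set ℕ) : Prop :=
  ∃ ρ : ℝ, 0 < ρ ∧ HasDensity N ρ ∧
    ∃ F : ℕ → ℕ → ℝ, (∀ q, 1 ≤ q → ∀ a, HasResidueDensity N q a (F q a)) ∧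
      1 / ρ = extremalSum F ρ

/-- `S(θ) = ∑_{n ≤ x, n ∈ N} e(θn)`. -/
noncomputable def expSum (N : Set ℕ) (x : ℕ) (θ : ℝ) : ℂ :=
  ∑ n ∈ (Finset.Icc 1 x).filter (fun n => n ∈ N), e (θ * n)

/-- Rational major arcs `M(x,Q)`. -/
def majorArcs (x Q : ℕ) : Set ℝ :=
  ⋃ q ∈ Finset.Icc 1 Q, ⋃ a ∈ (Finset.Icc 1 q).filter (fun a => Nat.Coprime a q),
    Set.Icc ((a : ℝ) / q - Q / x) ((a : ℝ) / q + Q / x)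

/-- Rational minor arcs `m(x,Q) = [0,1] \ M(x,Q)`. -/
def minorArcs (x Q : ℕ) : Set ℝ := Set.Icc 0 1 \ majorArcs x Q

/-- Characteristic function of a set of naturals. -/
noncomputable def charFun (N : Set ℕ) : ℕ → ℂ := fun n => if n ∈ N then 1 else 0

/-- A (nonconstant-period) periodic function on `ℕ`. -/
def IsPeriodicFn (g : ℕ → ℂ) : Prop := ∃ p : ℕ, 1 ≤ p ∧ ∀ n, g (n + p) = g n

/-- Trigonometric polynomials `n ↦ ∑ a_ν e(α_ν n)`. -/
def IsTrigPoly (g : ℕ → ℂ) : Prop :=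
  ∃ (k : ℕ) (a : Fin k → ℂ) (α : Fin k → ℝ), ∀ n : ℕ, g n = ∑ ν : Fin k, a ν * e (α ν * n)

/-- The seminorm `‖f‖₂ = (limsup_x (1/x) ∑_{n≤x} |f n|²)^{1/2}`. -/
noncomputable def seminorm2 (f : ℕ → ℂ) : ℝ :=
  Real.sqrt (Filter.limsup (fun x : ℕ => (∑ n ∈ Finset.Icc 1 x, ‖f n‖ ^ 2) / x) Filter.atTop)

/-- `f` lies in `A²`, the `‖·‖₂`-closure of the trigonometric polynomials. -/
def MemA2 (f : ℕ → ℂ) : Prop :=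
  ∀ ε : ℝ, 0 < ε → ∃ g : ℕ → ℂ, IsTrigPoly g ∧ seminorm2 (fun n => f n - g n) < ε

/-- `f` lies in `B²`, the `‖·‖₂`-closure of the periodic functions. -/
def MemB2 (f : ℕ → ℂ) : Prop :=
  ∀ ε : ℝ, 0 < ε → ∃ g : ℕ → ℂ, IsPeriodicFn g ∧ seminorm2 (fun n => f n - g n) < ε

/-- `f` is `B²`-almost periodic: there is a sequence of periodic functions `fq` with
`limsup_x (1/x) ∑_{n≤x} |f n - fq n|² → 0`. -/
def B2AlmostPeriodic (f : ℕ → ℂ) : Prop :=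
  ∃ fq : ℕ → ℕ → ℂ, (∀ q, IsPeriodicFn (fq q)) ∧
    Filter.Tendsto (fun q : ℕ =>
        Filter.limsup (fun x : ℕ => (∑ n ∈ Finset.Icc 1 x, ‖f n - fq q n‖ ^ 2) / x)
          Filter.atTop)
      Filter.atTop (nhds 0)

/-- The Fourier coefficient `⟨f, e_β⟩ = lim_x (1/x) ∑_{n≤x} f n e(-βn)` equals `c`. -/
def HasFourierCoeff (f : ℕ → ℂ) (β : ℝ) (c : ℂ) : Prop :=
  Filter.Tendsto (fun x : ℕ => (∑ n ∈ Finset.Icc 1 x, f n * e (-(β * n))) / (x : ℂ))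
    Filter.atTop (nhds c)

/-- The spectrum of `f`: those `β` with nonzero Fourier coefficient. -/
def spec (f : ℕ → ℂ) : Set ℝ := {β | ∃ c : ℂ, c ≠ 0 ∧ HasFourierCoeff f β c}

/-- Major arcs `M_α(x,Q)` relative to a sequence `α`. -/
def majorArcsAlpha (α : ℕ → ℝ) (x Q : ℕ) : Set ℝ :=
  ⋃ n : ℕ, ⋃ _ : n ≤ Q, Set.Icc (α n - Q / x) (α n + Q / x)

/-- Minor arcs `m_α(x,Q) = [0,1] \ M_α(x,Q)`. -/
def minorArcsAlpha (α : ℕ → ℝ) (x Q : ℕ) : Set ℝ := Set.Icc 0 1 \ majorArcsAlpha α x Q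

/-- `N` is `α`-extremal: it has positive density, all Fourier coefficients of its
characteristic function exist, and `∫_{m_α(x,Q(x))} |S|² = o(x)` for every `Q(x) → ∞`. -/
def AlphaExtremal (N : Set ℕ) (α : ℕ → ℝ) : Prop :=
  (∃ ρ : ℝ, 0 < ρ ∧ HasDensity N ρ) ∧
  (∀ β : ℝ, ∃ c : ℂ, HasFourierCoeff (charFun N) β c) ∧
  ∀ Q : ℕ → ℕ, Filter.Tendsto Q Filter.atTop Filter.atTop →
    Filter.Tendsto (fun x : ℕ =>
        (∫ θ in minorArcsAlpha α x (Q x), ‖expSum N x θ‖ ^ 2) / x)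
      Filter.atTop (nhds 0)

lemma e_add (s t : ℝ) : e (s + t) = e s * e t := by
  simp only [e, ← Complex.exp_add]
  congr 1
  push_cast
  ring

lemma e_natCast_mul (n : ℕ) (t : ℝ) : e (n * t) = e t ^ n := by
  simp only [e, ← Complex.exp_nat_mul]
  congr 1
  push_cast
  ring

lemma conj_e (t : ℝ) : (starRingEnd ℂ) (e t) = e (-t) := by
  simp only [e, ← Complex.exp_conj]
  congr 1
  have h2 : (starRingEnd ℂ) 2 = 2 := map_ofNat _ 2
  simp [h2]

lemma e_eq_one_iff (t : ℝ) : e t = 1 ↔ ∃ n : ℤ, t = n := by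
  rw [e, Complex.exp_eq_one_iff]
  have h2 : (2 * Real.pi * Complex.I : ℂ) ≠ 0 := Complex.two_pi_I_ne_zero
  refine exists_congr fun n => ?_
  rw [mul_comm (n : ℂ), mul_right_inj' h2]
  norm_cast

lemma e_intCast (n : ℤ) : e n = 1 := (e_eq_one_iff _).2 ⟨n, rfl⟩

/-- Orthogonality of the additive characters modulo `M`. -/
lemma sum_e_sub_div {M b c : ℕ} (hb : b ∈ Icc 1 M) (hc : c ∈ Icc 1 M) :
    ∑ j ∈ Icc 1 M, e (j * (((b : ℝ) - c) / M)) = if b = c then (M : ℂ) else 0 := by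
  rw [mem_Icc] at hb hc
  have hM : (M : ℝ) ≠ 0 := by
    have : M ≠ 0 := by omega
    exact_mod_cast this
  simp only [e_natCast_mul]
  split_ifs with h
  · subst h
    have : e 0 = 1 := by simpa using e_intCast 0
    simp [this]
  · set z := e (((b : ℝ) - c) / M) with hz
    have hzM : z ^ M = 1 := by
      rw [hz, ← e_natCast_mul, mul_div_cancel₀ _ hM]
      exact_mod_cast e_intCast ((b : ℤ) - c)
    have hz1 : z ≠ 1 := by
      intro h1
      obtain ⟨n, hn⟩ := (e_eq_one_iff _).1 h1
      rw [div_eq_iff hM] at hn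
      have hn' : (b : ℤ) - c = n * M := by exact_mod_cast hn
      have hdvd : (M : ℤ) ∣ (b : ℤ) - c := ⟨n, by rw [hn']; ring⟩
      have : (b : ℤ) - c = 0 := Int.eq_zero_of_abs_lt_dvd hdvd (by rw [abs_lt]; omega)
      omega
    have hIcc : Icc 1 M = Ico 1 (M + 1) := by ext; simp
    rw [hIcc, sum_Ico_eq_sum_range]
    simp only [Nat.add_sub_cancel, pow_add, pow_one, ← mul_sum]
    have hg := geom_sum_mul z M
    rw [hzM, sub_self, mul_eq_zero] at hg
    rw [hg.resolve_right (sub_ne_zero.2 hz1), mul_zero]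

/-- Parseval's identity modulo `M`. -/
lemma sum_norm_sq_sum_mul_e (M : ℕ) (c : ℕ → ℝ) :
    ∑ j ∈ Icc 1 M, ‖∑ b ∈ Icc 1 M, (c b : ℂ) * e (((j : ℝ) * b) / M)‖ ^ 2
      = M * ∑ b ∈ Icc 1 M, c b ^ 2 := by
  apply Complex.ofReal_injective
  push_cast
  have key : ∀ j : ℕ, ((‖∑ b ∈ Icc 1 M, (c b : ℂ) * e (((j : ℝ) * b) / M)‖ : ℂ)) ^ 2
      = ∑ b ∈ Icc 1 M, ∑ d ∈ Icc 1 M, (c b : ℂ) * c d * e (j * (((b : ℝ) - d) / M)) := by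
    intro j
    rw [← Complex.mul_conj', map_sum, sum_mul_sum]
    refine sum_congr rfl fun b _ => sum_congr rfl fun d _ => ?_
    rw [map_mul, conj_e, Complex.conj_ofReal,
      show (j : ℝ) * (((b : ℝ) - d) / M) = (j : ℝ) * b / M + -((j : ℝ) * d / M) by ring, e_add]
    ring
  simp only [key]
  rw [sum_comm, mul_sum]
  refine sum_congr rfl fun b hb => ?_
  rw [sum_comm]
  simp only [← mul_sum]
  rw [sum_congr rfl fun d hd => by rw [sum_e_sub_div hb hd]]
  simp only [mul_ite, mul_zero, sum_ite_eq, if_pos hb]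
  ring

/-- The fractions `j / M` in lowest terms. -/
lemma sum_Icc_eq_sum_divisors_coprime {M : ℕ} (hM : M ≠ 0) (g h : ℕ → ℕ → ℝ)
    (hgh : ∀ q ∈ M.divisors, ∀ a, h q a = g M (a * (M / q))) :
    ∑ j ∈ Icc 1 M, g M j
      = ∑ q ∈ M.divisors, ∑ a ∈ (Icc 1 q).filter (fun a => Nat.Coprime a q), h q a := by
  rw [sum_sigma']
  symm
  refine sum_nbij' (fun x => x.2 * (M / x.1)) (fun j => ⟨M / j.gcd M, j / j.gcd M⟩) ?_ ?_ ?_ ?_ ?_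
  · rintro ⟨q, a⟩ hx
    simp only [mem_sigma, Nat.mem_divisors, mem_filter, mem_Icc] at hx ⊢
    obtain ⟨⟨⟨k, rfl⟩, -⟩, ⟨ha1, ha2⟩, -⟩ := hx
    have hq : 0 < q := by omega
    have hk : 0 < k := Nat.pos_of_ne_zero (by rintro rfl; simp at hM)
    rw [Nat.mul_div_cancel_left _ hq]
    exact ⟨Nat.mul_pos ha1 hk, Nat.mul_le_mul_right _ ha2⟩
  · intro j hj
    simp only [mem_sigma, Nat.mem_divisors, mem_filter, mem_Icc] at hj ⊢
    have hg : 0 < j.gcd M := Nat.gcd_pos_of_pos_left _ hj.1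
    refine ⟨⟨Nat.div_dvd_of_dvd (Nat.gcd_dvd_right _ _), hM⟩,
      ⟨Nat.div_pos (Nat.le_of_dvd hj.1 (Nat.gcd_dvd_left _ _)) hg, Nat.div_le_div_right hj.2⟩,
      Nat.coprime_div_gcd_div_gcd hg⟩
  · rintro ⟨q, a⟩ hx
    simp only [mem_sigma, Nat.mem_divisors, mem_filter, mem_Icc] at hx
    obtain ⟨⟨⟨k, rfl⟩, -⟩, ⟨ha1, ha2⟩, hc⟩ := hx
    have hq : 0 < q := by omega
    have hk : 0 < k := Nat.pos_of_ne_zero (by rintro rfl; simp at hM)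
    simp only [Nat.mul_div_cancel_left _ hq, Nat.gcd_mul_right, hc.gcd_eq_one, one_mul,
      Nat.mul_div_cancel _ hk]
  · intro j hj
    rw [mem_Icc] at hj
    have hg : 0 < j.gcd M := Nat.gcd_pos_of_pos_left _ hj.1
    simp only
    rw [Nat.div_div_self (Nat.gcd_dvd_right _ _) hM, Nat.div_mul_cancel (Nat.gcd_dvd_left _ _)]
  · rintro ⟨q, a⟩ hx
    exact hgh q (mem_sigma.1 hx).1 a

/-- The number of elements of `S` in `[1, x]`. -/
noncomputable def countingFun (S : Set ℕ) (x : ℕ) : ℝ := ((Icc 1 x).filter (fun n => n ∈ S)).card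

lemma hasDensity_iff (S : Set ℕ) (d : ℝ) :
    HasDensity S d ↔ Tendsto (fun x : ℕ => countingFun S x / x) atTop (nhds d) := Iff.rfl

lemma hasResidueDensity_iff (N : Set ℕ) (q a : ℕ) (d : ℝ) :
    HasResidueDensity N q a d ↔ HasDensity {n | n ∈ N ∧ n % q = a % q} d := by
  simp only [HasResidueDensity, HasDensity, Set.mem_ofPred_eq]

lemma countingFun_mono {S T : Set ℕ} (h : ∀ n, 1 ≤ n → n ∈ S → n ∈ T) (x : ℕ) :
    countingFun S x ≤ countingFun T x := by
  unfold countingFun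
  refine Nat.cast_le.2 (card_le_card fun n hn => ?_)
  simp only [mem_filter, mem_Icc] at hn ⊢
  exact ⟨hn.1, h n hn.1.1 hn.2⟩

lemma HasDensity.le {S T : Set ℕ} {s t : ℝ} (hS : HasDensity S s) (hT : HasDensity T t)
    (h : ∀ n, 1 ≤ n → n ∈ S → n ∈ T) : s ≤ t :=
  le_of_tendsto_of_tendsto' hS hT fun x =>
    div_le_div_of_nonneg_right (countingFun_mono h x) x.cast_nonneg

lemma HasDensity.nonneg {S : Set ℕ} {s : ℝ} (hS : HasDensity S s) : 0 ≤ s :=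
  ge_of_tendsto' hS fun _ => by positivity

lemma hasDensity_residueClass {q : ℕ} (hq : 1 ≤ q) (a : ℕ) :
    HasDensity {n | n % q = a % q} (1 / q) := by
  have hq0 : (0 : ℝ) < q := by exact_mod_cast hq
  have hbd : ∀ x : ℕ, |countingFun {n | n % q = a % q} x - x / q| ≤ 1 := by
    intro x
    have hIcc : Icc 1 x = Ioc 0 x := by ext; simp; omega
    have := Nat.Ioc_filter_modEq_card 0 x (r := q) (by omega) a
    have h2 : (((Icc 1 x).filter (fun n => n % q = a % q)).card : ℝ)
        = (max (⌊((x : ℚ) - a) / q⌋ - ⌊(((0 : ℕ) : ℚ) - a) / q⌋) 0 : ℤ) := by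
      rw [hIcc]
      exact_mod_cast congrArg (Int.cast : ℤ → ℝ) this
    simp only [countingFun, Set.mem_ofPred_eq]
    rw [h2]
    have hqQ : (0 : ℚ) < q := by exact_mod_cast hq
    set u := ((x : ℚ) - a) / q with hu
    set v := (((0 : ℕ) : ℚ) - a) / q with hv
    have huv : u - v = x / q := by rw [hu, hv]; push_cast; ring
    have hvu : v ≤ u := by
      have : (0 : ℚ) ≤ x / q := by positivity
      linarith
    rw [max_eq_left (sub_nonneg.2 (Int.floor_mono hvu))]
    have : |((⌊u⌋ - ⌊v⌋ : ℤ) : ℚ) - x / q| ≤ 1 := by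
      rw [← huv, abs_le]
      have h1 := Int.floor_le u
      have h2 := Int.lt_floor_add_one u
      have h3 := Int.floor_le v
      have h4 := Int.lt_floor_add_one v
      push_cast
      constructor <;> linarith
    have hR := (Rat.cast_le (K := ℝ)).2 this
    push_cast at hR ⊢
    exact hR
  rw [hasDensity_iff, tendsto_iff_norm_sub_tendsto_zero]
  refine squeeze_zero' (Eventually.of_forall fun _ => norm_nonneg _) ?_
    tendsto_one_div_atTop_nhds_zero_nat
  filter_upwards [eventually_gt_atTop 0] with x hx
  have hx0 : (0 : ℝ) < x := by exact_mod_cast hx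
  rw [show countingFun {n | n % q = a % q} x / x - 1 / q
    = (countingFun {n | n % q = a % q} x - x / q) / x by field_simp, norm_div, Real.norm_eq_abs,
    Real.norm_of_nonneg hx0.le]
  exact div_le_div_of_nonneg_right (hbd x) hx0.le

lemma exists_unique_residue_mem_Icc {q : ℕ} (hq : 1 ≤ q) (n : ℕ) :
    ∃ b ∈ Icc 1 q, ∀ c ∈ Icc 1 q, n % q = c % q ↔ b = c := by
  have hlt := Nat.mod_lt n hq
  refine ⟨if n % q = 0 then q else n % q, ?_, fun c hc => ?_⟩
  · split_ifs <;> simp <;> omega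
  · rw [mem_Icc] at hc
    rcases hc.2.lt_or_eq with h | h
    · rw [Nat.mod_eq_of_lt h]
      split_ifs <;> omega
    · rw [h, Nat.mod_self]
      split_ifs <;> omega

/-- Mean values of `q`-periodic functions along `N`. -/
lemma tendsto_mean_of_hasResidueDensity {E : Type*} [NormedAddCommGroup E] [NormedSpace ℝ E]
    {N : Set ℕ} {q : ℕ} (hq : 1 ≤ q) {F : ℕ → ℝ} (hF : ∀ a, HasResidueDensity N q a (F a))
    (h : ℕ → E) (hh : ∀ m n, m % q = n % q → h m = h n) :
    Tendsto (fun x : ℕ => (x : ℝ)⁻¹ • ∑ n ∈ (Icc 1 x).filter (fun n => n ∈ N), h n) atTop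
      (nhds (∑ b ∈ Icc 1 q, F b • h b)) := by
  have hsum : ∀ x : ℕ, (x : ℝ)⁻¹ • ∑ n ∈ (Icc 1 x).filter (fun n => n ∈ N), h n
      = ∑ b ∈ Icc 1 q,
        ((((Icc 1 x).filter (fun n => n ∈ N ∧ n % q = b % q)).card : ℝ) / x) • h b := by
    intro x
    have : ∀ n, h n = ∑ b ∈ Icc 1 q, if n % q = b % q then h b else 0 := by
      intro n
      obtain ⟨b, hb, hbu⟩ := exists_unique_residue_mem_Icc hq n
      rw [sum_congr rfl fun c hc => by rw [if_congr (hbu c hc) rfl rfl]]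
      rw [sum_ite_eq, if_pos hb]
      exact hh _ _ ((hbu b hb).2 rfl)
    rw [sum_congr rfl fun n _ => this n, sum_comm, smul_sum]
    refine sum_congr rfl fun b _ => ?_
    rw [← sum_filter, filter_filter, sum_const, ← Nat.cast_smul_eq_nsmul ℝ, smul_smul,
      div_eq_inv_mul]
  simp only [hsum]
  exact tendsto_finsetSum _ fun b _ => (hF b).smul_const _

/-- The set `A` is a union of residue classes modulo `M`. -/
def IsPeriodicSet (A : Set ℕ) (M : ℕ) : Prop := ∀ m n, m % M = n % M → (m ∈ A ↔ n ∈ A)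

/-- `N` can be approximated from above by periodic sets. -/
def LimitPeriodic (N : Set ℕ) : Prop :=
  ∀ ε : ℝ, 0 < ε → ∃ (M : ℕ) (A : Set ℕ), 1 ≤ M ∧ IsPeriodicSet A M ∧
    (∀ n, 1 ≤ n → n ∈ N → n ∈ A) ∧ ∀ x : ℕ, countingFun A x ≤ countingFun N x + ε * x

/-- The density of the part of a periodic set lying in a distributed set. -/
lemma hasDensity_inter_periodic {N : Set ℕ} {q : ℕ} (hq : 1 ≤ q) {F : ℕ → ℝ}
    (hF : ∀ a, HasResidueDensity N q a (F a)) {A : Set ℕ} (hA : IsPeriodicSet A q) :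
    HasDensity {n | n ∈ N ∧ n ∈ A} (∑ b ∈ Icc 1 q, F b * if b ∈ A then 1 else 0) := by
  have := tendsto_mean_of_hasResidueDensity hq hF (fun n => if n ∈ A then (1 : ℝ) else 0)
    (fun m n hmn => by simp only [hA m n hmn])
  rw [hasDensity_iff]
  refine this.congr fun x => ?_
  rw [← sum_filter, filter_filter]
  simp [countingFun, div_eq_inv_mul]

lemma hasDensity_periodic {q : ℕ} (hq : 1 ≤ q) {A : Set ℕ} (hA : IsPeriodicSet A q) :
    HasDensity A (∑ b ∈ Icc 1 q, (1 / q : ℝ) * if b ∈ A then 1 else 0) := by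
  have := hasDensity_inter_periodic (N := Set.univ) hq (F := fun _ => 1 / q)
    (fun a => by simpa [hasResidueDensity_iff] using hasDensity_residueClass hq a) hA
  simpa using this

lemma exists_tendsto_of_approx {u : ℕ → ℝ}
    (h : ∀ ε : ℝ, 0 < ε → ∃ v : ℕ → ℝ, (∃ l, Tendsto v atTop (nhds l)) ∧
      ∀ᶠ x in atTop, |u x - v x| ≤ ε) : ∃ l, Tendsto u atTop (nhds l) := by
  refine cauchySeq_tendsto_of_complete (Metric.cauchySeq_iff'.2 fun ε hε => ?_)
  obtain ⟨v, ⟨l, hl⟩, huv⟩ := h (ε / 8) (by positivity)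
  have hvl := Metric.tendsto_nhds.1 hl (ε / 8) (by positivity)
  obtain ⟨n, hn⟩ := eventually_atTop.1 (huv.and hvl)
  refine ⟨n, fun m hm => ?_⟩
  obtain ⟨h1, h2⟩ := hn m hm
  obtain ⟨h3, h4⟩ := hn n le_rfl
  rw [Real.dist_eq, abs_lt] at *
  rw [abs_le] at h1 h3
  constructor <;> linarith [h1.1, h1.2, h3.1, h3.2, h2.1, h2.2, h4.1, h4.2]

lemma LimitPeriodic.distributed {N : Set ℕ} (hN : LimitPeriodic N) : Distributed N := by
  intro q hq a
  simp only [hasResidueDensity_iff]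
  refine exists_tendsto_of_approx fun ε hε => ?_
  obtain ⟨M, A, hM, hA, hNA, hcount⟩ := hN ε hε
  refine ⟨fun x => countingFun {n | n ∈ A ∧ n % q = a % q} x / x,
    ⟨_, hasDensity_periodic (q := M * q) (by nlinarith) fun m n hmn => ?_⟩, ?_⟩
  · have h1 : m % M = n % M := (show m ≡ n [MOD M * q] from hmn).of_mul_right q
    have h2 : m % q = n % q := (show m ≡ n [MOD M * q] from hmn).of_mul_left M
    simp only [Set.mem_ofPred_eq, hA m n h1, h2]
  · filter_upwards [eventually_gt_atTop 0] with x hx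
    have hx0 : (0 : ℝ) < x := by exact_mod_cast hx
    have hsplit : ∀ S : Set ℕ, countingFun S x = countingFun {n | n ∈ S ∧ n % q = a % q} x
        + countingFun {n | n ∈ S ∧ ¬ n % q = a % q} x := by
      intro S
      simp only [countingFun, Set.mem_ofPred_eq, ← filter_filter]
      exact_mod_cast (card_filter_add_card_filter_not _).symm
    have h1 : countingFun {n | n ∈ N ∧ n % q = a % q} x
        ≤ countingFun {n | n ∈ A ∧ n % q = a % q} x :=
      countingFun_mono (fun n hn h => And.intro (hNA n hn h.1) h.2) x
    have h2 : countingFun {n | n ∈ N ∧ ¬ n % q = a % q} x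
        ≤ countingFun {n | n ∈ A ∧ ¬ n % q = a % q} x :=
      countingFun_mono (fun n hn h => And.intro (hNA n hn h.1) h.2) x
    have h3 := hcount x
    rw [hsplit A, hsplit N] at h3
    change |countingFun {n | n ∈ N ∧ n % q = a % q} x / x - _| ≤ ε
    rw [← sub_div, abs_div, abs_of_pos hx0, div_le_iff₀ hx0, abs_le]
    constructor <;> linarith

lemma sum_coprime_norm_sq_eq {N : Set ℕ} {F : ℕ → ℕ → ℝ}
    (hF : ∀ q, 1 ≤ q → ∀ a, HasResidueDensity N q a (F q a)) {M : ℕ} (hM : 1 ≤ M) :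
    ∑ q ∈ M.divisors, ∑ a ∈ (Icc 1 q).filter (fun a => Nat.Coprime a q),
      ‖∑ b ∈ Icc 1 q, (F q b : ℂ) * e (((a : ℝ) * b) / q)‖ ^ 2
      = M * ∑ b ∈ Icc 1 M, F M b ^ 2 := by
  rw [← sum_norm_sq_sum_mul_e]
  symm
  refine sum_Icc_eq_sum_divisors_coprime (by omega)
    (fun q a => ‖∑ b ∈ Icc 1 q, (F q b : ℂ) * e (((a : ℝ) * b) / q)‖ ^ 2) _ fun q hq a => ?_
  obtain ⟨⟨k, rfl⟩, hM0⟩ := Nat.mem_divisors.1 hq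
  have hq1 : 1 ≤ q := Nat.pos_of_ne_zero (by rintro rfl; simp at hM0)
  have hk1 : 1 ≤ k := Nat.pos_of_ne_zero (by rintro rfl; simp at hM0)
  have hmean : ∀ Q : ℕ, 1 ≤ Q → ∀ c : ℕ,
      Tendsto (fun x : ℕ => (x : ℝ)⁻¹ • ∑ n ∈ (Icc 1 x).filter (fun n => n ∈ N),
        e (((c : ℝ) * n) / Q)) atTop
      (nhds (∑ b ∈ Icc 1 Q, (F Q b : ℂ) * e (((c : ℝ) * b) / Q))) := by
    intro Q hQ c
    have hQ0 : (Q : ℝ) ≠ 0 := by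
      have : Q ≠ 0 := by omega
      exact_mod_cast this
    have hper : ∀ n : ℕ, e (((c : ℝ) * n) / Q) = e (((c : ℝ) * (n % Q : ℕ)) / Q) := by
      intro n
      obtain ⟨m, hm⟩ : ∃ m : ℕ, n = Q * m + n % Q := ⟨n / Q, (Nat.div_add_mod n Q).symm⟩
      have hn : (n : ℝ) = (Q : ℝ) * m + (n % Q : ℕ) := by exact_mod_cast hm
      have : ((c : ℝ) * n) / Q = ((c * m : ℤ) : ℝ) + ((c : ℝ) * (n % Q : ℕ)) / Q := by
        rw [hn]
        push_cast
        field_simp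
      rw [this, e_add, e_intCast, one_mul]
    simpa only [Complex.real_smul] using tendsto_mean_of_hasResidueDensity hQ (hF Q hQ)
      (fun n => e (((c : ℝ) * n) / Q)) fun m n hmn => by
        rw [hper m, hper n, hmn]
  have := tendsto_nhds_unique (hmean q hq1 a)
    ((hmean (q * k) hM (a * (q * k / q))).congr fun x => ?_)
  · simp only [this]
  · congr 1
    refine sum_congr rfl fun n _ => ?_
    congr 1
    rw [Nat.mul_div_cancel_left _ hq1]
    have : (q : ℝ) ≠ 0 := by positivity
    have : (k : ℝ) ≠ 0 := by positivity
    push_cast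
    field_simp

theorem LimitPeriodic.extremal {N : Set ℕ} (hN : LimitPeriodic N) {ρ : ℝ} (hρ : 0 < ρ)
    (hd : HasDensity N ρ) : Extremal N := by
  choose! F hF using hN.distributed
  refine ⟨ρ, hρ, hd, F, hF, ?_⟩
  set g : ℕ → ℝ := fun q => ∑ a ∈ (Icc 1 q).filter (fun a => Nat.Coprime a q),
    ‖∑ b ∈ Icc 1 q, (F q b : ℂ) * e (((a : ℝ) * b) / q)‖ ^ 2 with hg
  have hg0 : ∀ q, 0 ≤ g q := fun q => sum_nonneg fun _ _ => by positivity
  have hF0 : ∀ M, 1 ≤ M → ∀ b, 0 ≤ F M b := fun M hM b =>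
    HasDensity.nonneg ((hasResidueDensity_iff _ _ _ _).1 (hF M hM b))
  have hF1 : ∀ M, 1 ≤ M → ∀ b, F M b ≤ 1 / M := fun M hM b =>
    HasDensity.le ((hasResidueDensity_iff _ _ _ _).1 (hF M hM b)) (hasDensity_residueClass hM b)
      fun _ _ h => h.2
  have hFsum : ∀ M, 1 ≤ M → ∑ b ∈ Icc 1 M, F M b = ρ := by
    intro M hM
    have := hasDensity_inter_periodic hM (hF M hM) (A := Set.univ) fun _ _ _ => Iff.rfl
    simp only [Set.mem_univ, and_true, Set.ofPred_mem_eq, if_true, mul_one] at this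
    exact tendsto_nhds_unique this hd
  have hupper : ∀ M, 1 ≤ M → ∑ q ∈ M.divisors, g q ≤ ρ := by
    intro M hM
    rw [hg, sum_coprime_norm_sq_eq hF hM, ← hFsum M hM, mul_sum]
    refine sum_le_sum fun b _ => ?_
    have hM0 : (0 : ℝ) < M := by exact_mod_cast hM
    have h1 := hF1 M hM b
    rw [le_div_iff₀ hM0] at h1
    nlinarith [hF0 M hM b]
  have hlower : ∀ ε : ℝ, 0 < ε → ∃ M : ℕ, ρ - ε ≤ ∑ q ∈ M.divisors, g q := by
    intro ε hε
    obtain ⟨M, A, hM, hA, hNA, hcount⟩ := hN ε hε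
    refine ⟨M, ?_⟩
    have hM0 : (0 : ℝ) < M := by exact_mod_cast hM
    have hdA := hasDensity_periodic hM hA
    have hAρ : ∑ b ∈ Icc 1 M, ((1 / M : ℝ) * if b ∈ A then 1 else 0) ≤ ρ + ε := by
      refine le_of_tendsto_of_tendsto hdA (hd.add_const ε) ?_
      filter_upwards [eventually_gt_atTop 0] with x hx
      have hx0 : (0 : ℝ) < x := by exact_mod_cast hx
      change countingFun A x / x ≤ countingFun N x / x + ε
      rw [div_le_iff₀ hx0, add_mul, div_mul_cancel₀ _ hx0.ne']
      exact hcount x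
    rw [hg, sum_coprime_norm_sq_eq hF hM]
    suffices h : ρ - M * ∑ b ∈ Icc 1 M, F M b ^ 2
        ≤ ∑ b ∈ Icc 1 M, ((1 / M : ℝ) * if b ∈ A then 1 else 0) - ρ by linarith
    nth_rewrite 1 2 [← hFsum M hM]
    rw [mul_sum, ← sum_sub_distrib, ← sum_sub_distrib]
    refine sum_le_sum fun b hb => ?_
    have h1 := hF1 M hM b
    have h0 := hF0 M hM b
    split_ifs with hbA
    · have h2 : (M : ℝ) * F M b ≤ 1 := by
        rw [le_div_iff₀ hM0] at h1
        linarith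
      have h3 : (M : ℝ) * (1 / M) = 1 := by field_simp
      nlinarith [mul_nonneg (sub_nonneg.2 h1) (sub_nonneg.2 h2)]
    · have hempty : HasDensity (∅ : Set ℕ) 0 := by simp [HasDensity]
      have hle : F M b ≤ 0 := by
        refine HasDensity.le ((hasResidueDensity_iff _ _ _ _).1 (hF M hM b)) hempty ?_
        rintro n hn ⟨hnN, hnb⟩
        exact (hbA ((hA n b hnb).1 (hNA n hn hnN))).elim
      have : F M b = 0 := le_antisymm hle h0
      simp [this]
  have hbound : ∀ s : Finset ℕ, ∑ q ∈ s, g q ≤ ρ := by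
    intro s
    have hpos : 1 ≤ ∏ q ∈ s.erase 0, q :=
      Nat.pos_of_ne_zero (prod_ne_zero_iff.2 fun q hq => (mem_erase.1 hq).1)
    refine le_trans ?_ (hupper _ hpos)
    have hg00 : g 0 = 0 := by simp [hg]
    rw [← sum_erase s hg00]
    refine sum_le_sum_of_subset_of_nonneg (fun q hq => ?_) fun q _ _ => hg0 q
    exact Nat.mem_divisors.2 ⟨dvd_prod_of_mem _ hq, by omega⟩
  have hsummable : Summable g := summable_of_sum_le hg0 hbound
  have htsum : ∑' q, g q = ρ := by
    refine le_antisymm (hsummable.tsum_le_of_sum_le hbound) (le_of_forall_pos_le_add fun ε hε => ?_)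
    obtain ⟨M, hM⟩ := hlower ε hε
    linarith [hsummable.sum_le_tsum M.divisors fun q _ => hg0 q]
  have hscale : ∀ q, ∑ a ∈ (Icc 1 q).filter (fun a => Nat.Coprime a q),
      ‖∑ b ∈ Icc 1 q, ((F q b / ρ : ℝ) : ℂ) * e (((a : ℝ) * b) / q)‖ ^ 2 = (ρ ^ 2)⁻¹ * g q := by
    intro q
    rw [hg, mul_sum]
    refine sum_congr rfl fun a _ => ?_
    have : ∑ b ∈ Icc 1 q, ((F q b / ρ : ℝ) : ℂ) * e (((a : ℝ) * b) / q)
        = ((ρ⁻¹ : ℝ) : ℂ) * ∑ b ∈ Icc 1 q, (F q b : ℂ) * e (((a : ℝ) * b) / q) := by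
      rw [mul_sum]
      refine sum_congr rfl fun b _ => ?_
      push_cast
      ring
    rw [this, norm_mul, mul_pow, Complex.norm_real, norm_inv, inv_pow, Real.norm_of_nonneg hρ.le]
  rw [extremalSum, tsum_congr hscale, tsum_mul_left, htsum]
  field_simp

lemma mul_mem_iff_of_charFun {N : Set ℕ}
    (hmul : ∀ m n : ℕ, Nat.Coprime m n → charFun N (m * n) = charFun N m * charFun N n)
    {m n : ℕ} (h : Nat.Coprime m n) : m * n ∈ N ↔ m ∈ N ∧ n ∈ N := by
  have := hmul m n h
  simp only [_root_.charFun] at this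
  by_cases h1 : m ∈ N <;> by_cases h2 : n ∈ N <;> simp_all

lemma prime_pow_mem_of_mem {N : Set ℕ}
    (hN : ∀ m n : ℕ, Nat.Coprime m n → (m * n ∈ N ↔ m ∈ N ∧ n ∈ N))
    {p k n : ℕ} (hp : p.Prime) (hn : n ∈ N) (h1 : p ^ k ∣ n) (h2 : ¬ p ^ (k + 1) ∣ n) : p ^ k ∈ N := by
  obtain ⟨m, rfl⟩ := h1
  refine ((hN (p ^ k) m (Nat.Coprime.pow_left _ ((hp.coprime_iff_not_dvd).2 fun h => h2 ?_))).1
    hn).1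
  rw [pow_succ]
  exact mul_dvd_mul_left _ h

lemma mem_of_forall_prime_pow_mem {N : Set ℕ}
    (hN : ∀ m n : ℕ, Nat.Coprime m n → (m * n ∈ N ↔ m ∈ N ∧ n ∈ N))
    (h1 : 1 ∈ N) {n : ℕ} (hn : n ≠ 0)
    (h : ∀ p k, p.Prime → p ^ k ∣ n → ¬ p ^ (k + 1) ∣ n → p ^ k ∈ N) : n ∈ N := by
  induction n using Nat.strong_induction_on with
  | _ n ih =>
  rcases eq_or_ne n 1 with rfl | hn1
  · exact h1
  have hp := Nat.minFac_prime hn1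
  have hpn := Nat.minFac_dvd n
  set p := n.minFac
  obtain ⟨k, m, hpm, hkm⟩ := Nat.exists_eq_pow_mul_and_not_dvd hn p hp.ne_one
  have hk : k ≠ 0 := by
    rintro rfl
    rw [pow_zero, one_mul] at hkm
    exact hpm (hkm ▸ hpn)
  have hm : m ≠ 0 := by
    rintro rfl
    exact hpm (dvd_zero p)
  have hcop : Nat.Coprime (p ^ k) m := Nat.Coprime.pow_left _ (hp.coprime_iff_not_dvd.2 hpm)
  have hlt : m < n := by
    have : 1 < p ^ k := Nat.one_lt_pow hk hp.one_lt
    rw [hkm]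
    nlinarith [Nat.pos_of_ne_zero hm]
  rw [hkm]
  refine (hN _ _ hcop).2 ⟨h p k hp (hkm ▸ dvd_mul_right _ _) fun hd => hpm ?_, ih m hlt hm ?_⟩
  · rw [hkm, pow_succ] at hd
    exact Nat.dvd_of_mul_dvd_mul_left (pow_pos hp.pos k) hd
  · intro r j hr hrj hrj'
    rcases eq_or_ne j 0 with rfl | hj
    · simpa using h1
    have hrp : r ≠ p := by
      intro h
      exact hpm (h ▸ (dvd_pow_self r hj).trans hrj)
    refine h r j hr (hkm ▸ hrj.mul_left _) fun hd => hrj' ?_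
    rw [hkm] at hd
    exact (Nat.Coprime.pow _ _ ((Nat.coprime_primes hr hp).2 hrp)).dvd_of_dvd_mul_left hd

lemma sq_dvd_of_mem {N : Set ℕ}
    (hN : ∀ m n : ℕ, Nat.Coprime m n → (m * n ∈ N ↔ m ∈ N ∧ n ∈ N))
    {p n : ℕ} (hp : p.Prime) (hpN : p ∉ N) (hn : n ∈ N)
    (hpn : p ∣ n) : p ^ 2 ∣ n := by
  by_contra h
  exact hpN (by simpa using prime_pow_mem_of_mem hN hp (k := 1) hn (by simpa using hpn) h)

lemma countingFun_multiples_le (d x : ℕ) : countingFun {n | d ∣ n} x ≤ (x : ℝ) / d := by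
  have hIcc : Icc 1 x = Ioc 0 x := by ext; simp; omega
  simp only [countingFun, Set.mem_ofPred_eq, hIcc, Nat.Ioc_filter_dvd_card_eq_div]
  exact Nat.cast_div_le

lemma countingFun_le_inter_add {N : Set ℕ}
    (hN : ∀ m n : ℕ, Nat.Coprime m n → (m * n ∈ N ↔ m ∈ N ∧ n ∈ N)) {p : ℕ} (hp : p.Prime)
    (hpN : p ∉ N) (y : ℕ) :
    countingFun N y ≤ countingFun {n | n ∈ N ∧ ¬ p ∣ n} y + (y : ℝ) / (p : ℝ) ^ 2 := by
  have h := countingFun_multiples_le (p ^ 2) y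
  rw [Nat.cast_pow] at h
  refine le_trans ?_ (add_le_add_right h _)
  simp only [countingFun, Set.mem_ofPred_eq]
  norm_cast
  refine le_trans (card_le_card fun n hn => ?_) (card_union_le _ _)
  simp only [mem_union, mem_filter] at hn ⊢
  by_cases hpn : p ∣ n
  · exact Or.inr ⟨hn.1, sq_dvd_of_mem hN hp hpN hn.2 hpn⟩
  · exact Or.inl ⟨hn.1, hn.2, hpn⟩

/-- The sets `p • {n ∈ N : p ∤ n}`, for primes `p ∉ N`, are disjoint. -/
lemma sum_countingFun_div_le {N : Set ℕ}
    (hN : ∀ m n : ℕ, Nat.Coprime m n → (m * n ∈ N ↔ m ∈ N ∧ n ∈ N)) (T : Finset ℕ)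
    (hT : ∀ p ∈ T, p.Prime ∧ p ∉ N) (x : ℕ) :
    ∑ p ∈ T, countingFun {n | n ∈ N ∧ ¬ p ∣ n} (x / p) ≤ x := by
  simp only [countingFun, Set.mem_ofPred_eq]
  norm_cast
  rw [← card_sigma]
  conv_rhs => rw [← Nat.add_sub_cancel x 1, ← Nat.card_Icc]
  refine card_le_card_of_injOn (fun z => z.1 * z.2) ?_ ?_
  · rintro ⟨p, n⟩ hz
    simp only [coe_sigma, Set.mem_sigma_iff, mem_coe, mem_filter, mem_Icc] at hz ⊢
    obtain ⟨hp, ⟨hn1, hn2⟩, -⟩ := hz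
    have hp0 := (hT p hp).1.pos
    refine ⟨Nat.mul_pos hp0 hn1, ?_⟩
    rw [mul_comm]
    exact (Nat.le_div_iff_mul_le hp0).1 hn2
  · rintro ⟨p, n⟩ hz ⟨r, m⟩ hw hzw
    simp only [coe_sigma, Set.mem_sigma_iff, mem_coe, mem_filter, mem_Icc] at hz hw hzw
    obtain ⟨hp, -, hn, hpn⟩ := hz
    obtain ⟨hr, -, hm, -⟩ := hw
    have hp' := (hT p hp).1
    have hr' := (hT r hr).1
    rcases eq_or_ne p r with rfl | hpr
    · rw [Nat.eq_of_mul_eq_mul_left hp'.pos hzw]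
    have hcop : Nat.Coprime p r := (Nat.coprime_primes hp' hr').2 hpr
    have hpm : p ∣ m := hcop.dvd_of_dvd_mul_left (hzw ▸ dvd_mul_right p n)
    have hd : p ^ 2 ∣ p * n := hzw ▸ (sq_dvd_of_mem hN hp' (hT p hp).2 hm hpm).mul_left r
    rw [pow_two] at hd
    exact (hpn (Nat.dvd_of_mul_dvd_mul_left hp'.pos hd)).elim

/-- If `N` has positive density, the primes outside `N` are sparse. -/
lemma summable_inv_primes_not_mem {N : Set ℕ}
    (hN : ∀ m n : ℕ, Nat.Coprime m n → (m * n ∈ N ↔ m ∈ N ∧ n ∈ N)) {ρ : ℝ} (hρ : 0 < ρ)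
    (hd : HasDensity N ρ) :
    Summable (fun p : ℕ => if p.Prime ∧ p ∉ N then (1 : ℝ) / p else 0) := by
  have hcube : Summable (fun p : ℕ => (1 : ℝ) / (p : ℝ) ^ 3) :=
    Real.summable_one_div_nat_pow.2 (by norm_num)
  refine summable_of_sum_le (c := (1 + ∑' p : ℕ, (1 : ℝ) / (p : ℝ) ^ 3) / ρ)
    (fun p => by positivity) fun u => ?_
  rw [← sum_filter]
  set T := u.filter (fun p => p.Prime ∧ p ∉ N)
  have hT : ∀ p ∈ T, p.Prime ∧ p ∉ N := fun p hp => (mem_filter.1 hp).2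
  have hlim : ∑ p ∈ T, (ρ - 1 / (p : ℝ) ^ 2) / p ≤ 1 := by
    set P := ∏ p ∈ T, p
    have hP : 0 < P := prod_pos fun p hp => (hT p hp).1.pos
    have hPp : ∀ p ∈ T, 0 < P / p := fun p hp =>
      Nat.div_pos (Nat.le_of_dvd hP (dvd_prod_of_mem _ hp)) (hT p hp).1.pos
    have ht : Tendsto (fun t : ℕ => ∑ p ∈ T,
        (countingFun N (P / p * t) / (P / p * t : ℕ) - 1 / (p : ℝ) ^ 2) / p) atTop
        (nhds (∑ p ∈ T, (ρ - 1 / (p : ℝ) ^ 2) / p)) := by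
      refine tendsto_finsetSum _ fun p hp => Tendsto.div_const (Tendsto.sub_const ?_ _) _
      exact ((hasDensity_iff _ _).1 hd).comp (tendsto_id.const_mul_atTop' (hPp p hp))
    refine le_of_tendsto ht ?_
    filter_upwards [eventually_gt_atTop 0] with t ht0
    have hPt : (0 : ℝ) < (P * t : ℕ) := by exact_mod_cast Nat.mul_pos hP ht0
    have hmain := sum_countingFun_div_le hN T hT (P * t)
    refine le_trans (sum_le_sum (g := fun p =>
      countingFun {n | n ∈ N ∧ ¬ p ∣ n} (P * t / p) / (P * t : ℕ)) fun p hp => ?_) ?_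
    · obtain ⟨k, hk⟩ : p ∣ P := dvd_prod_of_mem _ hp
      have hp0 : 0 < p := (hT p hp).1.pos
      have hpR : (0 : ℝ) < p := by exact_mod_cast hp0
      have hk0 : 0 < k := Nat.pos_of_ne_zero (by rintro rfl; omega)
      have hktR : (0 : ℝ) < (k * t : ℕ) := by exact_mod_cast Nat.mul_pos hk0 ht0
      have hcount := countingFun_le_inter_add hN (hT p hp).1 (hT p hp).2 (k * t)
      rw [hk, mul_assoc, Nat.mul_div_cancel_left _ hp0, Nat.mul_div_cancel_left _ hp0,
        Nat.cast_mul p, div_le_div_iff₀ hpR (by positivity)]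
      rw [show (countingFun N (k * t) / (k * t : ℕ) - 1 / (p : ℝ) ^ 2) * (p * (k * t : ℕ))
        = (countingFun N (k * t) - (k * t : ℕ) / (p : ℝ) ^ 2) * p by field_simp]
      exact mul_le_mul_of_nonneg_right (by linarith) hpR.le
    · rw [← sum_div]
      exact div_le_one_of_le₀ hmain hPt.le
  rw [le_div_iff₀ hρ, sum_mul]
  have hle : ∑ p ∈ T, (1 : ℝ) / (p : ℝ) ^ 3 ≤ ∑' p : ℕ, (1 : ℝ) / (p : ℝ) ^ 3 :=
    hcube.sum_le_tsum T fun _ _ => by positivity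
  have hsplit : ∑ p ∈ T, (ρ - 1 / (p : ℝ) ^ 2) / p
      = ∑ p ∈ T, 1 / (p : ℝ) * ρ - ∑ p ∈ T, (1 : ℝ) / (p : ℝ) ^ 3 := by
    rw [← sum_sub_distrib]
    refine sum_congr rfl fun p hp => ?_
    have : (p : ℝ) ≠ 0 := by exact_mod_cast (hT p hp).1.ne_zero
    field_simp
  linarith

lemma isPeriodicSet_prime_powers (N : Set ℕ) (s : Finset ℕ) (K : ℕ) :
    IsPeriodicSet {n | ∀ p ∈ s, ∀ k < K, p ^ k ∣ n → ¬ p ^ (k + 1) ∣ n → p ^ k ∈ N}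
      ((∏ p ∈ s, p) ^ K) := by
  intro m n hmn
  have hdvd : ∀ p ∈ s, ∀ k ≤ K, p ^ k ∣ m ↔ p ^ k ∣ n := fun p hp k hk =>
    Nat.ModEq.dvd_iff hmn ((pow_dvd_pow p hk).trans (pow_dvd_pow_of_dvd (dvd_prod_of_mem _ hp) K))
  refine forall₄_congr fun p hp k hk => ?_
  rw [hdvd p hp k hk.le, hdvd p hp (k + 1) hk]

theorem limitPeriodic_of_multiplicative {N : Set ℕ}
    (hN : ∀ m n : ℕ, Nat.Coprime m n → (m * n ∈ N ↔ m ∈ N ∧ n ∈ N)) {ρ : ℝ} (hρ : 0 < ρ)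
    (hd : HasDensity N ρ) : LimitPeriodic N := by
  intro ε hε
  have h1 : 1 ∈ N := by
    by_contra h1
    have hempty : N = ∅ := Set.eq_empty_of_forall_notMem fun n hn =>
      h1 ((hN 1 n (Nat.coprime_one_left n)).1 (by simpa using hn)).1
    have : HasDensity N 0 := by simp [HasDensity, hempty]
    exact hρ.ne' (tendsto_nhds_unique hd this)
  set g : ℕ → ℝ := fun p => (if p.Prime ∧ p ∉ N then (1 : ℝ) / p else 0) + 1 / (p : ℝ) ^ 2 with hg
  have hgs : Summable g :=
    (summable_inv_primes_not_mem hN hρ hd).add (Real.summable_one_div_nat_pow.2 (by norm_num))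
  obtain ⟨s₀, hs₀⟩ := summable_iff_vanishing_norm.1 hgs (ε / 2) (by positivity)
  set s := s₀.filter Nat.Prime
  obtain ⟨K, hK⟩ : ∃ K : ℕ, ∑ p ∈ s, (1 : ℝ) / ((p ^ K : ℕ) : ℝ) ≤ ε / 2 := by
    have : Tendsto (fun K : ℕ => ∑ p ∈ s, (1 : ℝ) / ((p ^ K : ℕ) : ℝ)) atTop
        (nhds (∑ p ∈ s, (0 : ℝ))) := by
      refine tendsto_finsetSum _ fun p hp => ?_
      have hp1 : 1 < (p : ℝ) := by exact_mod_cast (mem_filter.1 hp).2.one_lt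
      simpa [Function.comp_def] using tendsto_inv_atTop_zero.comp (tendsto_pow_atTop_atTop_of_one_lt hp1)
    rw [sum_const_zero] at this
    exact (this.eventually (ge_mem_nhds (by positivity : (0 : ℝ) < ε / 2))).exists
  refine ⟨_, _, ?_, isPeriodicSet_prime_powers N s K, ?_, fun x => ?_⟩
  · exact Nat.pow_pos (prod_pos fun p hp => (mem_filter.1 hp).2.pos)
  · intro n _ hn p hp k _ hk hk'
    exact prime_pow_mem_of_mem hN (mem_filter.1 hp).2 hn hk hk'
  set A : Set ℕ := {n | ∀ p ∈ s, ∀ k < K, p ^ k ∣ n → ¬ p ^ (k + 1) ∣ n → p ^ k ∈ N}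
  set D : ℕ → Finset ℕ := fun d => (Icc 1 x).filter (fun n => d ∣ n)
  have hDcard : ∀ d : ℕ, ((D d).card : ℝ) ≤ x / d := fun d => by
    simpa only [countingFun, Set.mem_ofPred_eq] using countingFun_multiples_le d x
  set t := (range (x + 1)).filter (fun p => p.Prime ∧ p ∉ s₀)
  set R : ℕ → Finset ℕ := fun p => (if p ∉ N then D p else ∅) ∪ D (p ^ 2)
  have hRcard : ∀ p ∈ t, ((R p).card : ℝ) ≤ x * g p := by
    intro p hp
    have hp' := (mem_filter.1 hp).2.1
    have h2 := hDcard (p ^ 2)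
    refine le_trans (Nat.cast_le.2 (card_union_le _ _)) ?_
    rw [Nat.cast_add, hg, mul_add]
    refine add_le_add ?_ (by rw [mul_one_div]; exact_mod_cast h2)
    by_cases hpN : p ∈ N
    · simp [hpN]
    · simpa [hpN, hp', div_eq_mul_inv] using hDcard p
  have hsub : (Icc 1 x).filter (fun n => n ∈ A)
      ⊆ (Icc 1 x).filter (fun n => n ∈ N) ∪ (s.biUnion (fun p => D (p ^ K)) ∪ t.biUnion R) := by
    intro n hn
    obtain ⟨hnx, hnA⟩ := mem_filter.1 hn
    have hnx' := mem_Icc.1 hnx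
    by_cases hnN : n ∈ N
    · exact mem_union_left _ (mem_filter.2 ⟨hnx, hnN⟩)
    obtain ⟨p, k, hp, hk, hk', hkN⟩ :
        ∃ p k, p.Prime ∧ p ^ k ∣ n ∧ ¬ p ^ (k + 1) ∣ n ∧ p ^ k ∉ N := by
      by_contra! h
      exact hnN (mem_of_forall_prime_pow_mem hN h1 (by omega) h)
    refine mem_union_right _ ?_
    by_cases hps : p ∈ s₀
    · have hps' : p ∈ s := mem_filter.2 ⟨hps, hp⟩
      have hKk : K ≤ k := by
        by_contra! h
        exact hkN (hnA p hps' k h hk hk')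
      exact mem_union_left _ (mem_biUnion.2
        ⟨p, hps', mem_filter.2 ⟨hnx, (pow_dvd_pow p hKk).trans hk⟩⟩)
    · have hk0 : k ≠ 0 := by
        rintro rfl
        exact hkN (by simpa using h1)
      have hpn : p ∣ n := (dvd_pow_self p hk0).trans hk
      have hpx : p < x + 1 := by
        have := Nat.le_of_dvd hnx'.1 hpn
        omega
      refine mem_union_right _ (mem_biUnion.2
        ⟨p, mem_filter.2 ⟨mem_range.2 hpx, hp, hps⟩, ?_⟩)
      rcases eq_or_ne k 1 with rfl | hk1
      · rw [pow_one] at hkN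
        refine mem_union_left _ ?_
        rw [if_pos hkN]
        exact mem_filter.2 ⟨hnx, hpn⟩
      · exact mem_union_right _ (mem_filter.2
          ⟨hnx, (pow_dvd_pow p (by omega : 2 ≤ k)).trans hk⟩)
  have hcard := (card_le_card hsub).trans ((card_union_le _ _).trans (add_le_add_right
    ((card_union_le _ _).trans (add_le_add card_biUnion_le card_biUnion_le)) _))
  have hcardR : countingFun A x
      ≤ countingFun N x + (∑ p ∈ s, ((D (p ^ K)).card : ℝ) + ∑ p ∈ t, ((R p).card : ℝ)) := by
    unfold countingFun
    refine le_trans (le_of_eq ?_) (((Nat.cast_le (α := ℝ)).2 hcard).trans (le_of_eq ?_))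
    · congr!
    · push_cast
      rfl
  have hx0 : (0 : ℝ) ≤ x := x.cast_nonneg
  have hs : ∑ p ∈ s, ((D (p ^ K)).card : ℝ) ≤ x * (ε / 2) := by
    refine le_trans (sum_le_sum fun p _ => hDcard (p ^ K)) ?_
    refine le_trans (le_of_eq ?_) (mul_le_mul_of_nonneg_left hK hx0)
    rw [mul_sum]
    exact sum_congr rfl fun p _ => by rw [mul_one_div]
  have hts : ∑ p ∈ t, ((R p).card : ℝ) ≤ x * (ε / 2) := by
    refine le_trans (sum_le_sum hRcard) ?_
    rw [← mul_sum]
    refine mul_le_mul_of_nonneg_left ((le_abs_self _).trans (hs₀ t ?_).le) hx0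
    exact disjoint_left.2 fun p hp => (mem_filter.1 hp).2.2
  linarith

/-- a set of positive density whose characteristic function is
multiplicative is extremal. -/
theorem stmt_3 (N : Set ℕ) (hd : ∃ ρ : ℝ, 0 < ρ ∧ HasDensity N ρ)
    (hmul : ∀ m n : ℕ, Nat.Coprime m n → charFun N (m * n) = charFun N m * charFun N n) :
    Extremal N := by
  obtain ⟨ρ, hρ, hd⟩ := hd
  exact (limitPeriodic_of_multiplicative (fun _ _ => mul_mem_iff_of_charFun hmul) hρ hd).extremal
    hρ hd
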